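/- Let 0 < α ≤ 2, 0 < β < min(α,1), τ > 0 and r > 0. For c > 0 define K_c(x) := c^{−α} ∫_ℝ |f_{cτ}(x,s)|^α ds for x > 0. Then lim_{c→0} ∫_0^∞ (e^{−r K_c(x)} − 1) x^{β−1} dx = ∫_0^∞ (e^{−r τ^α/(α x)} − 1) x^{β−1} dx = −(Γ(1−β)/β) (rτ^α/α)^β. -/

import Mathlib

open MeasureTheory Filter Set

/-- `f_τ(x,s) := ∫_0^τ e^{−x(t−s)} 1(s ≤ t) dt`. -/
noncomputable def fker (τ x s : ℝ) : ℝ :=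
  ∫ t in Set.Ioc (0:ℝ) τ, if s ≤ t then Real.exp (-x * (t - s)) else 0

lemma one_sub_exp_div_nonneg {x u : ℝ} (hx : 0 < x) (hu : 0 ≤ u) :
    0 ≤ (1 - Real.exp (-x * u)) / x :=
  div_nonneg (sub_nonneg.2 (Real.exp_le_one_iff.2 (by nlinarith))) hx.le

lemma one_sub_exp_div_le {x : ℝ} (hx : 0 < x) (u : ℝ) :
    (1 - Real.exp (-x * u)) / x ≤ u := by
  rw [div_le_iff₀ hx]
  linarith [Real.add_one_le_exp (-x * u)]

lemma one_sub_exp_div_le_inv {x : ℝ} (hx : 0 < x) (u : ℝ) :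
    (1 - Real.exp (-x * u)) / x ≤ x⁻¹ := by
  rw [div_eq_mul_inv]
  exact mul_le_of_le_one_left (inv_pos.2 hx).le (by linarith [Real.exp_pos (-x * u)])

lemma integral_exp_neg_mul_sub {x : ℝ} (hx : 0 < x) (s a b : ℝ) :
    ∫ t in a..b, Real.exp (-x * (t - s))
      = (Real.exp (-x * (a - s)) - Real.exp (-x * (b - s))) / x := by
  rw [intervalIntegral.integral_eq_sub_of_hasDerivAt
    (f := fun t => -Real.exp (-x * (t - s)) / x)]
  · ring
  · intro t _
    have h := ((((hasDerivAt_id t).sub_const s).const_mul (-x)).exp.neg).div_const x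
    refine h.congr_deriv ?_
    simp only [id]
    field_simp
  · exact Continuous.intervalIntegrable (by fun_prop) _ _

lemma fker_of_nonpos {τ x s : ℝ} (hτ : 0 ≤ τ) (hx : 0 < x) (hs : s ≤ 0) :
    fker τ x s = Real.exp (x * s) * ((1 - Real.exp (-x * τ)) / x) := by
  have h : fker τ x s = ∫ t in (0 : ℝ)..τ, Real.exp (-x * (t - s)) := by
    rw [intervalIntegral.integral_of_le hτ]
    exact setIntegral_congr_fun measurableSet_Ioc fun t ht => if_pos (hs.trans ht.1.le)
  have e : Real.exp (-x * (τ - s)) = Real.exp (x * s) * Real.exp (-x * τ) := by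
    rw [← Real.exp_add]; ring_nf
  rw [h, integral_exp_neg_mul_sub hx, e, show -x * (0 - s) = x * s by ring]
  ring

lemma fker_of_mem_Ioc {τ x s : ℝ} (hx : 0 < x) (hs : s ∈ Ioc 0 τ) :
    fker τ x s = (1 - Real.exp (-x * (τ - s))) / x := by
  have h : fker τ x s = ∫ t in s..τ, Real.exp (-x * (t - s)) := by
    have h1 : fker τ x s
        = ∫ t in Ioc 0 τ, (Ici s).indicator (fun t => Real.exp (-x * (t - s))) t := rfl
    have h2 : Ioc 0 τ ∩ Ici s = Icc s τ := by
      ext t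
      simp only [mem_inter_iff, mem_Ioc, mem_Ici, mem_Icc]
      exact ⟨fun h => ⟨h.2, h.1.2⟩, fun h => ⟨⟨hs.1.trans_le h.1, h.2⟩, h.1⟩⟩
    rw [intervalIntegral.integral_of_le hs.2, h1, setIntegral_indicator measurableSet_Ici, h2,
      integral_Icc_eq_integral_Ioc]
  rw [h, integral_exp_neg_mul_sub hx]
  simp

lemma fker_of_lt {τ x s : ℝ} (hs : τ < s) : fker τ x s = 0 := by
  refine setIntegral_eq_zero_of_forall_eq_zero fun t ht => if_neg ?_
  exact not_le.2 (ht.2.trans_lt hs)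

lemma abs_fker_rpow_integral {α τ x : ℝ} (hα : 0 < α) (hτ : 0 ≤ τ) (hx : 0 < x) :
    ∫ s : ℝ, |fker τ x s| ^ α
      = ((1 - Real.exp (-x * τ)) / x) ^ α / (α * x)
        + ∫ s in Ioc 0 τ, ((1 - Real.exp (-x * (τ - s))) / x) ^ α := by
  have hA := one_sub_exp_div_nonneg hx hτ
  have e1 : EqOn (fun s => |fker τ x s| ^ α)
      (fun s => Real.exp (α * x * s) * ((1 - Real.exp (-x * τ)) / x) ^ α) (Iic 0) := by
    intro s hs
    simp only
    rw [fker_of_nonpos hτ hx hs, abs_of_nonneg (by positivity),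
      Real.mul_rpow (Real.exp_pos _).le hA, ← Real.exp_mul]
    ring_nf
  have e2 : EqOn (fun s => |fker τ x s| ^ α)
      (fun s => ((1 - Real.exp (-x * (τ - s))) / x) ^ α) (Ioc 0 τ) := by
    intro s hs
    simp only
    rw [fker_of_mem_Ioc hx hs, abs_of_nonneg (one_sub_exp_div_nonneg hx (sub_nonneg.2 hs.2))]
  have e3 : EqOn (fun s => |fker τ x s| ^ α) (fun _ => 0) (Ioi τ) := by
    intro s hs
    simp only
    rw [fker_of_lt hs, abs_zero, Real.zero_rpow hα.ne']
  have i1 : IntegrableOn (fun s => |fker τ x s| ^ α) (Iic 0) :=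
    IntegrableOn.congr_fun ((integrableOn_exp_mul_Iic (mul_pos hα hx) 0).mul_const _) e1.symm
      measurableSet_Iic
  have i2 : IntegrableOn (fun s => |fker τ x s| ^ α) (Ioc 0 τ) := by
    refine IntegrableOn.congr_fun ?_ e2.symm measurableSet_Ioc
    refine (Continuous.integrableOn_Icc ?_).mono_set Ioc_subset_Icc_self
    exact Continuous.rpow_const (by fun_prop) fun _ => Or.inr hα.le
  have i3 : IntegrableOn (fun s => |fker τ x s| ^ α) (Ioi τ) :=
    integrableOn_zero.congr_fun e3.symm measurableSet_Ioi
  have i23 : IntegrableOn (fun s => |fker τ x s| ^ α) (Ioi 0) := by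
    rw [← Ioc_union_Ioi_eq_Ioi hτ]; exact i2.union i3
  rw [← intervalIntegral.integral_Iic_add_Ioi i1 i23, ← Ioc_union_Ioi_eq_Ioi hτ,
    setIntegral_union (Ioc_disjoint_Ioi le_rfl) measurableSet_Ioi i2 i3,
    setIntegral_congr_fun measurableSet_Iic e1, setIntegral_congr_fun measurableSet_Ioc e2,
    setIntegral_congr_fun measurableSet_Ioi e3, integral_mul_const,
    integral_exp_mul_Iic (mul_pos hα hx)]
  simp
  ring

lemma integral_one_sub_exp_div_rpow_nonneg {α τ x : ℝ} (hx : 0 < x) :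
    0 ≤ ∫ s in Ioc 0 τ, ((1 - Real.exp (-x * (τ - s))) / x) ^ α :=
  setIntegral_nonneg measurableSet_Ioc fun _ hs =>
    Real.rpow_nonneg (one_sub_exp_div_nonneg hx (sub_nonneg.2 hs.2)) _

lemma integral_one_sub_exp_div_rpow_le {α τ x δ : ℝ} (hτ : 0 < τ) (hx : 0 < x)
    (hδ : 0 ≤ δ) (hδα : δ ≤ α) :
    ∫ s in Ioc 0 τ, ((1 - Real.exp (-x * (τ - s))) / x) ^ α
      ≤ τ ^ α * τ ^ (1 - δ) * x ^ (-δ) := by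
  have hle : ∀ s ∈ Ioc 0 τ, ‖((1 - Real.exp (-x * (τ - s))) / x) ^ α‖
      ≤ τ ^ α * (x⁻¹ / τ) ^ δ := by
    intro s hs
    have hg0 := one_sub_exp_div_nonneg hx (sub_nonneg.2 hs.2)
    have hgτ : (1 - Real.exp (-x * (τ - s))) / x ≤ τ :=
      (one_sub_exp_div_le hx _).trans (by linarith [hs.1])
    have hgx := one_sub_exp_div_le_inv hx (τ - s)
    set g := (1 - Real.exp (-x * (τ - s))) / x
    have hg : g ^ α = τ ^ α * (g / τ) ^ α := by
      rw [← Real.mul_rpow hτ.le (by positivity), mul_div_cancel₀ _ hτ.ne']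
    rw [Real.norm_of_nonneg (by positivity), hg]
    gcongr
    calc (g / τ) ^ α ≤ (g / τ) ^ δ := by
          rcases hg0.eq_or_lt with h | h
          · rw [← h, zero_div]
            rcases hδ.eq_or_lt with h' | h'
            · rw [← h', Real.rpow_zero]; exact Real.zero_rpow_le_one _
            · rw [Real.zero_rpow h'.ne', Real.zero_rpow (h'.trans_le hδα).ne']
          · exact Real.rpow_le_rpow_of_exponent_ge (by positivity) ((div_le_one hτ).2 hgτ) hδα
      _ ≤ (x⁻¹ / τ) ^ δ := by gcongr
  have h := norm_setIntegral_le_of_norm_le_const (μ := volume) measure_Ioc_lt_top hle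
  refine (le_abs_self _).trans (h.trans_eq ?_)
  rw [measureReal_def, Real.volume_Ioc, ENNReal.toReal_ofReal (by linarith),
    Real.div_rpow (by positivity) hτ.le, Real.inv_rpow hx.le, Real.rpow_sub hτ, Real.rpow_one,
    Real.rpow_neg hx.le]
  ring

lemma abs_exp_neg_sub_one_le_one {k : ℝ} (hk : 0 ≤ k) : |Real.exp (-k) - 1| ≤ 1 := by
  rw [abs_le]
  constructor <;> linarith [Real.exp_pos (-k), Real.exp_le_one_iff.2 (neg_nonpos.2 hk)]

lemma abs_exp_neg_sub_one_le {k : ℝ} (hk : 0 ≤ k) : |Real.exp (-k) - 1| ≤ k := by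
  rw [abs_le]
  constructor <;> linarith [Real.add_one_le_exp (-k), Real.exp_le_one_iff.2 (neg_nonpos.2 hk)]

lemma integrableOn_ite_rpow {β δ : ℝ} (C : ℝ) (hβ : 0 < β) (hδ : β < δ) :
    IntegrableOn (fun x : ℝ => if x ≤ 1 then x ^ (β - 1) else C * x ^ (β - 1 - δ)) (Ioi 0) := by
  rw [← Ioc_union_Ioi_eq_Ioi zero_le_one]
  refine IntegrableOn.union ?_ ?_
  · have h := (intervalIntegral.intervalIntegrable_rpow' (a := 0) (b := 1)
      (show -1 < β - 1 by linarith)).1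
    exact h.congr_fun (fun x hx => (if_pos hx.2).symm) measurableSet_Ioc
  · have h := (integrableOn_Ioi_rpow_of_lt (show β - 1 - δ < -1 by linarith)
      zero_lt_one).const_mul C
    exact IntegrableOn.congr_fun h (fun x hx => (if_neg (not_le.2 hx)).symm) measurableSet_Ioi

lemma abs_exp_neg_sub_one_mul_rpow_le {β δ C k x : ℝ} (hx : 0 < x) (hk : 0 ≤ k)
    (hkC : 1 < x → k ≤ C * x ^ (-δ)) :
    ‖(Real.exp (-k) - 1) * x ^ (β - 1)‖
      ≤ if x ≤ 1 then x ^ (β - 1) else C * x ^ (β - 1 - δ) := by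
  have hp : 0 ≤ x ^ (β - 1) := by positivity
  rw [norm_mul, Real.norm_eq_abs, Real.norm_of_nonneg hp]
  split_ifs with h
  · exact mul_le_of_le_one_left hp (abs_exp_neg_sub_one_le_one hk)
  · calc |Real.exp (-k) - 1| * x ^ (β - 1) ≤ (C * x ^ (-δ)) * x ^ (β - 1) := by
          gcongr
          exact (abs_exp_neg_sub_one_le hk).trans (hkC (not_le.1 h))
      _ = C * x ^ (β - 1 - δ) := by
          rw [mul_assoc, ← Real.rpow_add hx]; ring_nf

lemma integrableOn_exp_neg_div_sub_one_mul_rpow {A β : ℝ} (hA : 0 < A) (hβ0 : 0 < β)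
    (hβ1 : β < 1) :
    IntegrableOn (fun x => (Real.exp (-(A / x)) - 1) * x ^ (β - 1)) (Ioi 0) := by
  refine Integrable.mono' (integrableOn_ite_rpow A hβ0 hβ1)
    (Measurable.aestronglyMeasurable (by fun_prop)) ?_
  filter_upwards [ae_restrict_mem measurableSet_Ioi] with x (hx : 0 < x)
  refine abs_exp_neg_sub_one_mul_rpow_le hx (by positivity) fun _ => ?_
  rw [Real.rpow_neg_one, div_eq_mul_inv]

lemma rpow_mul_exp_neg_div_eqOn (A β : ℝ) :
    EqOn (fun x : ℝ => (|(-1 : ℝ)| * x ^ ((-1 : ℝ) - 1)) •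
        ((x ^ (-1 : ℝ)) ^ (1 - β - 1) * Real.exp (-(A * x ^ (-1 : ℝ)))))
      (fun x => x ^ (β - 2) * Real.exp (-(A / x))) (Ioi 0) := by
  intro x (hx : 0 < x)
  simp only [smul_eq_mul, abs_neg, abs_one, one_mul]
  rw [← Real.rpow_mul hx.le, ← mul_assoc, ← Real.rpow_add hx, Real.rpow_neg_one, ← div_eq_mul_inv]
  ring_nf

lemma integrableOn_rpow_mul_exp_neg_div {A β : ℝ} (hA : 0 < A) (hβ1 : β < 1) :
    IntegrableOn (fun x => x ^ (β - 2) * Real.exp (-(A / x))) (Ioi 0) := by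
  have h := integrableOn_rpow_mul_exp_neg_mul_rpow (p := 1) (s := 1 - β - 1) (b := A)
    (by linarith) one_pos hA
  simp only [Real.rpow_one, neg_mul] at h
  exact ((integrableOn_Ioi_comp_rpow_iff _ (show (-1 : ℝ) ≠ 0 by norm_num)).2 h).congr_fun
    (rpow_mul_exp_neg_div_eqOn A β) measurableSet_Ioi

lemma integral_rpow_mul_exp_neg_div {A β : ℝ} (hA : 0 < A) (hβ1 : β < 1) :
    ∫ x in Ioi 0, x ^ (β - 2) * Real.exp (-(A / x)) = A ^ (β - 1) * Real.Gamma (1 - β) := by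
  rw [← setIntegral_congr_fun measurableSet_Ioi (rpow_mul_exp_neg_div_eqOn A β),
    integral_comp_rpow_Ioi (fun y => y ^ (1 - β - 1) * Real.exp (-(A * y))) (by norm_num),
    Real.integral_rpow_mul_exp_neg_mul_Ioi (by linarith) hA, one_div, Real.inv_rpow hA.le,
    ← Real.rpow_neg hA.le]
  ring_nf

lemma integral_exp_neg_div_sub_one_mul_rpow {A β : ℝ} (hA : 0 < A) (hβ0 : 0 < β) (hβ1 : β < 1) :
    ∫ x in Ioi 0, (Real.exp (-(A / x)) - 1) * x ^ (β - 1)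
      = -(Real.Gamma (1 - β) / β) * A ^ β := by
  have hd1 : ∀ x ∈ Ioi (0 : ℝ), HasDerivAt (fun x => Real.exp (-(A / x)) - 1)
      (A * x ^ (-2 : ℝ) * Real.exp (-(A / x))) x := by
    intro x (hx : 0 < x)
    have h := ((((hasDerivAt_inv hx.ne').const_mul A).neg).exp.sub_const 1)
    refine h.congr_deriv ?_
    rw [Real.rpow_neg hx.le, Real.rpow_two, div_eq_mul_inv]
    simp
    ring
  have hd2 : ∀ x ∈ Ioi (0 : ℝ), HasDerivAt (fun x => x ^ β / β) (x ^ (β - 1)) x := by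
    intro x (hx : 0 < x)
    refine ((Real.hasDerivAt_rpow_const (Or.inl hx.ne')).div_const β).congr_deriv ?_
    field_simp
  have e : EqOn (fun x => A * x ^ (-2 : ℝ) * Real.exp (-(A / x)) * (x ^ β / β))
      (fun x => A / β * (x ^ (β - 2) * Real.exp (-(A / x)))) (Ioi 0) := by
    intro x (hx : 0 < x)
    simp only
    rw [show β - 2 = -2 + β by ring, Real.rpow_add hx]
    ring
  have hbd : ∀ x : ℝ, 0 < x →
      ‖(Real.exp (-(A / x)) - 1) * (x ^ β / β)‖ = |Real.exp (-(A / x)) - 1| * (x ^ β / β) := by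
    intro x hx
    rw [norm_mul, Real.norm_eq_abs, Real.norm_of_nonneg (by positivity)]
  have h0 : Tendsto ((fun x => Real.exp (-(A / x)) - 1) * fun x => x ^ β / β)
      (nhdsWithin 0 (Ioi 0)) (nhds 0) := by
    refine squeeze_zero_norm' (a := fun x => x ^ β / β) ?_ ?_
    · filter_upwards [self_mem_nhdsWithin] with x (hx : 0 < x)
      rw [Pi.mul_apply, hbd x hx]
      exact mul_le_of_le_one_left (by positivity) (abs_exp_neg_sub_one_le_one (by positivity))
    · have h := ((Real.continuousAt_rpow_const 0 β (Or.inr hβ0.le)).div_const β).tendsto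
      rw [Real.zero_rpow hβ0.ne', zero_div] at h
      exact h.mono_left nhdsWithin_le_nhds
  have h1 : Tendsto ((fun x => Real.exp (-(A / x)) - 1) * fun x => x ^ β / β)
      atTop (nhds 0) := by
    refine squeeze_zero_norm' (a := fun x => A / β * x ^ (-(1 - β))) ?_ ?_
    · filter_upwards [eventually_gt_atTop 0] with x hx
      rw [Pi.mul_apply, hbd x hx]
      calc |Real.exp (-(A / x)) - 1| * (x ^ β / β) ≤ A / x * (x ^ β / β) := by
            gcongr
            exact abs_exp_neg_sub_one_le (by positivity)
        _ = A / β * x ^ (-(1 - β)) := by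
            rw [neg_sub, Real.rpow_sub hx, Real.rpow_one]
            ring
    · simpa using (tendsto_rpow_neg_atTop (show 0 < 1 - β by linarith)).const_mul (A / β)
  rw [integral_Ioi_mul_deriv_eq_deriv_mul hd1 hd2
    (integrableOn_exp_neg_div_sub_one_mul_rpow hA hβ0 hβ1)
    (IntegrableOn.congr_fun ((integrableOn_rpow_mul_exp_neg_div hA hβ1).const_mul (A / β)) e.symm
      measurableSet_Ioi) h0 h1, setIntegral_congr_fun measurableSet_Ioi e, integral_const_mul,
    integral_rpow_mul_exp_neg_div hA hβ1, Real.rpow_sub hA, Real.rpow_one]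
  field_simp
  ring

lemma rpow_neg_mul_div {c a : ℝ} (α : ℝ) (hc : 0 < c) (ha : 0 ≤ a) :
    c ^ (-α) * a ^ α = (a / c) ^ α := by
  rw [Real.div_rpow ha hc.le, Real.rpow_neg hc.le]
  ring

lemma rescaled_integral_nonneg {α τ x c : ℝ} (hc : 0 < c) :
    0 ≤ c ^ (-α) * ∫ s : ℝ, |fker (c * τ) x s| ^ α :=
  mul_nonneg (by positivity) (integral_nonneg fun _ => by positivity)

lemma rescaled_integral_eq {α τ x c : ℝ} (hα : 0 < α) (hτ : 0 < τ) (hx : 0 < x) (hc : 0 < c) :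
    c ^ (-α) * ∫ s : ℝ, |fker (c * τ) x s| ^ α
      = ((1 - Real.exp (-x * (c * τ))) / x / c) ^ α / (α * x)
        + c ^ (-α) * ∫ s in Ioc 0 (c * τ), ((1 - Real.exp (-x * (c * τ - s))) / x) ^ α := by
  rw [abs_fker_rpow_integral hα (by positivity) hx,
    ← rpow_neg_mul_div α hc (one_sub_exp_div_nonneg hx (by positivity))]
  ring

lemma rescaled_remainder_le {α τ x c δ : ℝ} (hτ : 0 < τ) (hx : 0 < x) (hc : 0 < c)
    (hδ : 0 ≤ δ) (hδα : δ ≤ α) :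
    c ^ (-α) * ∫ s in Ioc 0 (c * τ), ((1 - Real.exp (-x * (c * τ - s))) / x) ^ α
      ≤ τ ^ α * (c * τ) ^ (1 - δ) * x ^ (-δ) := by
  calc _ ≤ c ^ (-α) * ((c * τ) ^ α * (c * τ) ^ (1 - δ) * x ^ (-δ)) := by
        gcongr
        exact integral_one_sub_exp_div_rpow_le (by positivity) hx hδ hδα
    _ = (c ^ (-α) * (c * τ) ^ α) * (c * τ) ^ (1 - δ) * x ^ (-δ) := by ring
    _ = _ := by rw [rpow_neg_mul_div α hc (by positivity), mul_div_cancel_left₀ _ hc.ne']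

lemma rescaled_integral_le {α τ x c δ : ℝ} (hα : 0 < α) (hτ : 0 < τ) (hx : 1 < x) (hc : 0 < c)
    (hc1 : c ≤ 1) (hδ : 0 ≤ δ) (hδα : δ ≤ α) (hδ1 : δ ≤ 1) :
    c ^ (-α) * ∫ s : ℝ, |fker (c * τ) x s| ^ α
      ≤ (τ ^ α / α + τ ^ α * τ ^ (1 - δ)) * x ^ (-δ) := by
  have hx0 : 0 < x := by linarith
  rw [rescaled_integral_eq hα hτ hx0 hc, add_mul]
  gcongr ?_ + ?_
  · have h0 := one_sub_exp_div_nonneg hx0 (mul_pos hc hτ).le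
    have h1 : (1 - Real.exp (-x * (c * τ))) / x / c ≤ τ := by
      rw [div_le_iff₀ hc, mul_comm τ]
      exact one_sub_exp_div_le hx0 _
    have h2 : x⁻¹ ≤ x ^ (-δ) := by
      rw [← Real.rpow_neg_one]
      exact Real.rpow_le_rpow_of_exponent_le hx.le (by linarith)
    calc _ ≤ τ ^ α / (α * x) := by gcongr
      _ = τ ^ α / α * x⁻¹ := by field_simp
      _ ≤ _ := by gcongr
  · refine (rescaled_remainder_le hτ hx0 hc hδ hδα).trans ?_
    have h : c * τ ≤ τ := mul_le_of_le_one_left hτ.le hc1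
    gcongr

lemma tendsto_rescaled_integral {α τ x : ℝ} (hα : 0 < α) (hτ : 0 < τ) (hx : 0 < x) :
    Tendsto (fun c : ℝ => c ^ (-α) * ∫ s : ℝ, |fker (c * τ) x s| ^ α)
      (nhdsWithin 0 (Ioi 0)) (nhds (τ ^ α / (α * x))) := by
  have hd : HasDerivAt (fun c : ℝ => (1 - Real.exp (-x * (c * τ))) / x) τ 0 := by
    have h := (((((hasDerivAt_id (0 : ℝ)).mul_const τ).const_mul (-x)).exp.const_sub 1).div_const x)
    refine h.congr_deriv ?_
    simp
    field_simp
  have h1 : Tendsto (fun c : ℝ => (1 - Real.exp (-x * (c * τ))) / x / c)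
      (nhdsWithin 0 (Ioi 0)) (nhds τ) := by
    refine (hd.tendsto_slope_zero_right).congr fun c => ?_
    simp
    ring
  have h2 : Tendsto (fun c : ℝ => c ^ (-α) *
      ∫ s in Ioc 0 (c * τ), ((1 - Real.exp (-x * (c * τ - s))) / x) ^ α)
      (nhdsWithin 0 (Ioi 0)) (nhds 0) := by
    refine squeeze_zero' (g := fun c => τ ^ α * (c * τ)) ?_ ?_ ?_
    · filter_upwards [self_mem_nhdsWithin] with c (hc : 0 < c)
      exact mul_nonneg (by positivity) (integral_one_sub_exp_div_rpow_nonneg hx)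
    · filter_upwards [self_mem_nhdsWithin] with c (hc : 0 < c)
      simpa using rescaled_remainder_le hτ hx hc le_rfl hα.le
    · have h : Continuous fun c : ℝ => τ ^ α * (c * τ) := by fun_prop
      simpa using (h.tendsto 0).mono_left nhdsWithin_le_nhds
  have h3 := ((h1.rpow_const (p := α) (Or.inr hα.le)).div_const (α * x)).add h2
  rw [add_zero] at h3
  refine h3.congr' ?_
  filter_upwards [self_mem_nhdsWithin] with c (hc : 0 < c)
  exact (rescaled_integral_eq hα hτ hx hc).symm

lemma aestronglyMeasurable_integral_abs_fker_rpow {α τ : ℝ} (hα : 0 < α) (hτ : 0 ≤ τ) :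
    AEStronglyMeasurable (fun x => ∫ s : ℝ, |fker τ x s| ^ α) (volume.restrict (Ioi 0)) := by
  have hm : StronglyMeasurable fun x : ℝ =>
      ∫ s in Ioc 0 τ, ((1 - Real.exp (-x * (τ - s))) / x) ^ α := by
    refine StronglyMeasurable.integral_prod_right
      (f := fun x s => ((1 - Real.exp (-x * (τ - s))) / x) ^ α) (Measurable.stronglyMeasurable ?_)
    simp only [Function.uncurry_def]
    fun_prop
  have hm1 : Measurable fun x : ℝ => ((1 - Real.exp (-x * τ)) / x) ^ α / (α * x) := by fun_prop
  refine (hm1.stronglyMeasurable.add hm).aestronglyMeasurable.congr ?_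
  filter_upwards [ae_restrict_mem measurableSet_Ioi] with x hx
  exact (abs_fker_rpow_integral hα hτ hx).symm

/-- the small-scale asymptotic self-similarity limit of `Z_{α,β}`
towards the sub-stable random line `V_{α,β}·τ` (Proposition 3.1(v),
case `0 < β < min(α,1)`), at the level of characteristic exponents with `ω ≡ 1`:
with `K_c(x) := c^{−α} ∫_ℝ |f_{cτ}(x,s)|^α ds`,
`lim_{c→0} ∫_0^∞ (e^{−rK_c(x)} − 1)x^{β−1} dx = ∫_0^∞ (e^{−rτ^α/(αx)} − 1)x^{β−1} dx
  = −(Γ(1−β)/β)(rτ^α/α)^β`. -/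
theorem stmt_11 (α β τ r : ℝ) (hα0 : 0 < α) (hα2 : α ≤ 2) (hβ0 : 0 < β)
    (hβ : β < min α 1) (hτ : 0 < τ) (hr : 0 < r) :
    Filter.Tendsto (fun c : ℝ =>
        ∫ x in Set.Ioi (0:ℝ),
          (Real.exp (-r * (c ^ (-α) * ∫ s : ℝ, |fker (c * τ) x s| ^ α)) - 1) * x ^ (β - 1))
      (nhdsWithin 0 (Set.Ioi 0))
      (nhds (∫ x in Set.Ioi (0:ℝ),
        (Real.exp (-r * τ ^ α / (α * x)) - 1) * x ^ (β - 1))) ∧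
    (∫ x in Set.Ioi (0:ℝ), (Real.exp (-r * τ ^ α / (α * x)) - 1) * x ^ (β - 1))
      = -(Real.Gamma (1 - β) / β) * (r * τ ^ α / α) ^ β := by
  have hA : 0 < r * τ ^ α / α := by positivity
  have hβ1 : β < 1 := hβ.trans_le (min_le_right _ _)
  have hexp : ∀ x, -r * τ ^ α / (α * x) = -(r * τ ^ α / α / x) := fun x => by
    rw [div_div]; ring
  refine ⟨?_, ?_⟩
  · refine tendsto_integral_filter_of_dominated_convergence _ ?_ ?_
      (integrableOn_ite_rpow
        (r * (τ ^ α / α + τ ^ α * τ ^ (1 - min α 1))) hβ0 hβ) ?_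
    · filter_upwards [self_mem_nhdsWithin] with c (hc : 0 < c)
      have hm := aestronglyMeasurable_integral_abs_fker_rpow hα0 (mul_pos hc hτ).le
      have hp : Measurable fun x : ℝ => x ^ (β - 1) := by fun_prop
      exact ((Real.continuous_exp.comp_aestronglyMeasurable
        ((hm.const_mul _).const_mul _)).sub aestronglyMeasurable_const).mul
          hp.aestronglyMeasurable
    · filter_upwards [Ioc_mem_nhdsGT zero_lt_one] with c hc
      filter_upwards [ae_restrict_mem measurableSet_Ioi] with x (hx : 0 < x)
      rw [neg_mul]
      refine abs_exp_neg_sub_one_mul_rpow_le hx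
        (mul_nonneg hr.le (rescaled_integral_nonneg hc.1)) fun hx1 => ?_
      rw [mul_assoc]
      exact mul_le_mul_of_nonneg_left (rescaled_integral_le hα0 hτ hx1 hc.1 hc.2
        (le_min hα0.le zero_le_one) (min_le_left _ _) (min_le_right _ _)) hr.le
    · filter_upwards [ae_restrict_mem measurableSet_Ioi] with x (hx : 0 < x)
      have h := (tendsto_rescaled_integral hα0 hτ hx).const_mul (-r)
      rw [← mul_div_assoc] at h
      exact (((Real.continuous_exp.tendsto _).comp h).sub_const 1).mul_const _
  · simp only [hexp]
    exact integral_exp_neg_div_sub_one_mul_rpow hA hβ0 hβ1
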